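/- arXiv:2112.01666 — 2 statements merged into one kernel-verified Lean document; each statement's English description precedes it below -/
import Mathlib

section
/- Let φ = (1+√5)/2 and let 𝒱 ⊂ ℝ³ be the set of the N = 12 vertices of the regular icosahedron: all cyclic permutations of the coordinates of (0,±1,±φ). Then max_{v ∈ 𝒱^N̲} |⟨v⟩|₂² = 4136 + 1848√5. Consequently, for the unit-normalized ensemble 𝒱/√((5+√5)/2) one has g = (16544 + 7392√5)/(10 + 2√5), and its minimum guesswork is (1/2)·(13 − √g/12) ≈ 4.5081. -/
open Pointwise

noncomputable section

abbrev E3 := EuclideanSpace ℝ (Fin 3)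

/-- The vector `(a, b, c)` in ℝ³ with the Euclidean norm. -/
def vec3 (a b c : ℝ) : E3 := (WithLp.equiv 2 (Fin 3 → ℝ)).symm ![a, b, c]

/-- `⟨v⟩ := Σ_{i=1}^N (2i − N + 1)·vᵢ` (here `i : Fin N` is 0-based, so the
coefficient reads `2(i+1) − N + 1 = 2i + 3 − N`). -/
def tupleAvg (N : ℕ) (v : Fin N → E3) : E3 :=
  ∑ i : Fin N, (2 * (i : ℝ) + 3 - N) • v i

/-- The set of values `|⟨v⟩|₂²` as `v` ranges over the `N`-tuples on `𝒱` without
repetition (i.e. bijective enumerations of `𝒱`). -/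
def normSqSet (𝒱 : Set E3) (N : ℕ) : Set ℝ :=
  {x | ∃ v : Fin N → E3, Function.Injective v ∧ Set.range v = 𝒱 ∧ x = ‖tupleAvg N v‖ ^ 2}

/-- All cyclic coordinate permutations of `(0, ±x, ±y)`. -/
def cycSet (x y : ℝ) : Set E3 :=
  {v | ∃ c : Fin 3, ∃ s t : ℝ, (s = 1 ∨ s = -1) ∧ (t = 1 ∨ t = -1) ∧
       v = (WithLp.equiv 2 (Fin 3 → ℝ)).symm (fun i => ![0, s * x, t * y] (i + c))}

/-- The vertices of the regular icosahedron: all cyclic permutations of `(0, ±1, ±φ)`,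
with `φ = (1 + √5)/2` the golden ratio. -/
def icosahedron : Set E3 := cycSet 1 ((1 + Real.sqrt 5) / 2)

/-- The vertices `(0, ±1, ±φ)`, up to cyclic permutation, listed so that `i` and `11 - i` are
antipodal; for `φ` the golden ratio the functional `(34, 44, 72)` is increasing along the list. -/
def vertexList (φ : ℝ) : Fin 12 → E3 :=
  ![!₂[0, -1, -φ], !₂[-φ, 0, -1], !₂[-1, -φ, 0], !₂[0, 1, -φ], !₂[1, -φ, 0], !₂[φ, 0, -1],
    !₂[-φ, 0, 1], !₂[-1, φ, 0], !₂[0, -1, φ], !₂[1, φ, 0], !₂[φ, 0, 1], !₂[0, 1, φ]]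

theorem vertexList_injective {φ : ℝ} (h₁ : 1.6 < φ) (h₂ : φ < 1.7) :
    Function.Injective (vertexList φ) := by
  have hmono : StrictMono fun i => 34 * vertexList φ i 0 + 44 * vertexList φ i 1 +
      72 * vertexList φ i 2 := by
    refine Fin.strictMono_iff_lt_succ.2 fun i => ?_
    fin_cases i <;> simp [vertexList] <;> linarith
  exact fun i j h => hmono.injective (by simp [h])

theorem range_vertexList (φ : ℝ) : Set.range (vertexList φ) = cycSet 1 φ := by
  ext v
  constructor
  · rintro ⟨i, rfl⟩
    have key (c : Fin 3) (s t : ℝ) (hs : s = 1 ∨ s = -1) (ht : t = 1 ∨ t = -1)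
        (h : ∀ k : Fin 3, vertexList φ i k = ![0, s * 1, t * φ] (k + c)) :
        vertexList φ i ∈ cycSet 1 φ := by
      refine ⟨c, s, t, hs, ht, ?_⟩
      ext k
      simpa using h k
    fin_cases i
    · exact key 0 (-1) (-1) (by simp) (by simp) (by intro k; fin_cases k <;> simp [vertexList])
    · exact key 2 (-1) (-1) (by simp) (by simp) (by intro k; fin_cases k <;> simp [vertexList])
    · exact key 1 (-1) (-1) (by simp) (by simp) (by intro k; fin_cases k <;> simp [vertexList])
    · exact key 0 1 (-1) (by simp) (by simp) (by intro k; fin_cases k <;> simp [vertexList])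
    · exact key 1 1 (-1) (by simp) (by simp) (by intro k; fin_cases k <;> simp [vertexList])
    · exact key 2 (-1) 1 (by simp) (by simp) (by intro k; fin_cases k <;> simp [vertexList])
    · exact key 2 1 (-1) (by simp) (by simp) (by intro k; fin_cases k <;> simp [vertexList])
    · exact key 1 (-1) 1 (by simp) (by simp) (by intro k; fin_cases k <;> simp [vertexList])
    · exact key 0 (-1) 1 (by simp) (by simp) (by intro k; fin_cases k <;> simp [vertexList])
    · exact key 1 1 1 (by simp) (by simp) (by intro k; fin_cases k <;> simp [vertexList])
    · exact key 2 1 1 (by simp) (by simp) (by intro k; fin_cases k <;> simp [vertexList])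
    · exact key 0 1 1 (by simp) (by simp) (by intro k; fin_cases k <;> simp [vertexList])
  · rintro ⟨c, s, t, hs, ht, rfl⟩
    have key (i : Fin 12) (h : ∀ k : Fin 3, vertexList φ i k = ![0, s * 1, t * φ] (k + c)) :
        (WithLp.equiv 2 (Fin 3 → ℝ)).symm (fun k => ![0, s * 1, t * φ] (k + c)) ∈
          Set.range (vertexList φ) := by
      refine ⟨i, ?_⟩
      ext k
      simpa using h k
    rcases hs with rfl | rfl <;> rcases ht with rfl | rfl <;> fin_cases c
    · exact key 11 (by intro k; fin_cases k <;> simp [vertexList])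
    · exact key 9 (by intro k; fin_cases k <;> simp [vertexList])
    · exact key 10 (by intro k; fin_cases k <;> simp [vertexList])
    · exact key 3 (by intro k; fin_cases k <;> simp [vertexList])
    · exact key 4 (by intro k; fin_cases k <;> simp [vertexList])
    · exact key 6 (by intro k; fin_cases k <;> simp [vertexList])
    · exact key 8 (by intro k; fin_cases k <;> simp [vertexList])
    · exact key 7 (by intro k; fin_cases k <;> simp [vertexList])
    · exact key 5 (by intro k; fin_cases k <;> simp [vertexList])
    · exact key 0 (by intro k; fin_cases k <;> simp [vertexList])
    · exact key 2 (by intro k; fin_cases k <;> simp [vertexList])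
    · exact key 1 (by intro k; fin_cases k <;> simp [vertexList])

theorem norm_sq_sum_vertexList (φ : ℝ) (y : Fin 12 → ℝ) :
    ‖∑ j, (2 * y j - 9) • vertexList φ j‖ ^ 2 =
      4 * ((y 9 - y 2 + (y 4 - y 7) + φ * (y 10 - y 1 - (y 6 - y 5))) ^ 2 +
        (y 11 - y 0 + (y 3 - y 8) + φ * (y 9 - y 2 - (y 4 - y 7))) ^ 2 +
        (y 10 - y 1 + (y 6 - y 5) + φ * (y 11 - y 0 - (y 3 - y 8))) ^ 2) := by
  rw [EuclideanSpace.real_norm_sq_eq, Fin.sum_univ_three]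
  simp only [WithLp.ofLp_sum, Finset.sum_apply, WithLp.ofLp_smul, Pi.smul_apply, smul_eq_mul]
  simp [Fin.sum_univ_succ, vertexList]
  ring

theorem sum_sq_antipodal_diff_le (τ : Equiv.Perm (Fin 12)) (y : Fin 12 → ℤ)
    (hy : ∀ j, y j = (τ j : ℕ)) :
    (y 11 - y 0) ^ 2 + (y 3 - y 8) ^ 2 + (y 9 - y 2) ^ 2 + (y 4 - y 7) ^ 2 +
      (y 10 - y 1) ^ 2 + (y 6 - y 5) ^ 2 ≤ 286 := by
  have h : ∑ j, (2 * y j - 11) ^ 2 = 572 := by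
    simp only [hy]
    rw [Equiv.sum_comp τ fun k : Fin 12 => (2 * ((k : ℕ) : ℤ) - 11) ^ 2]
    decide
  simp only [Fin.sum_univ_succ] at h
  simp at h
  change (2 * y 0 - 11) ^ 2 + ((2 * y 1 - 11) ^ 2 + ((2 * y 2 - 11) ^ 2 + ((2 * y 3 - 11) ^ 2 +
    ((2 * y 4 - 11) ^ 2 + ((2 * y 5 - 11) ^ 2 + ((2 * y 6 - 11) ^ 2 + ((2 * y 7 - 11) ^ 2 +
    ((2 * y 8 - 11) ^ 2 + ((2 * y 9 - 11) ^ 2 + ((2 * y 10 - 11) ^ 2 +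
    (2 * y 11 - 11) ^ 2)))))))))) = 572 at h
  linarith [sq_nonneg (y 11 + y 0 - 11), sq_nonneg (y 3 + y 8 - 11), sq_nonneg (y 9 + y 2 - 11),
    sq_nonneg (y 4 + y 7 - 11), sq_nonneg (y 10 + y 1 - 11), sq_nonneg (y 6 + y 5 - 11)]

/-- The cross term of the quadratic form is bounded by its value at the optimum: the form obtained
by replacing the golden ratio with its conjugate is nonnegative, and the cross term is an
integer. -/
theorem cross_term_le (a b c d e f : ℤ)
    (h : a ^ 2 + b ^ 2 + c ^ 2 + d ^ 2 + e ^ 2 + f ^ 2 ≤ 286) :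
    -a * b - c * d - e * f + (c + d) * (e - f) + (a + b) * (c - d) + (e + f) * (a - b) ≤ 319 := by
  by_contra! hq
  have h' : (a : ℝ) ^ 2 + b ^ 2 + c ^ 2 + d ^ 2 + e ^ 2 + f ^ 2 ≤ 286 := by exact_mod_cast h
  have hq' : (320 : ℝ) ≤ -a * b - c * d - e * f + (c + d) * (e - f) + (a + b) * (c - d) +
      (e + f) * (a - b) := by exact_mod_cast hq
  obtain ⟨ψ, hψ, hlo, hhi⟩ : ∃ ψ : ℝ, ψ ^ 2 = ψ + 1 ∧ -1 < ψ ∧ ψ < -0.618 := by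
    have h5 : Real.sqrt 5 ^ 2 = 5 := Real.sq_sqrt (by norm_num)
    have h5lo : 2.236 < Real.sqrt 5 := Real.lt_sqrt_of_sq_lt (by norm_num)
    have h5hi : Real.sqrt 5 < 3 := (Real.sqrt_lt' (by norm_num)).2 (by norm_num)
    exact ⟨(1 - Real.sqrt 5) / 2, by linear_combination h5 / 4, by linarith, by linarith⟩
  set s : ℝ := (a : ℝ) ^ 2 + b ^ 2 + c ^ 2 + d ^ 2 + e ^ 2 + f ^ 2 with hs
  set q : ℝ := -a * b - c * d - e * f + (c + d) * (e - f) + (a + b) * (c - d) +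
      (e + f) * (a - b) with hqdef
  have hnn : 0 ≤ 2 * s + ψ * (s + 2 * q) := by
    have heq : 2 * s + ψ * (s + 2 * q) = (c + d + ψ * (e - f)) ^ 2 + (a + b + ψ * (c - d)) ^ 2 +
        (e + f + ψ * (a - b)) ^ 2 := by
      rw [hs, hqdef]
      linear_combination (-((e - f : ℝ) ^ 2 + (c - d) ^ 2 + (a - b) ^ 2)) * hψ
    rw [heq]
    positivity
  have hs0 : 0 ≤ s := by positivity
  nlinarith

theorem norm_sq_sum_perm_le {φ : ℝ} (hφ : φ ^ 2 = φ + 1) (hpos : 0 < φ)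
    (τ : Equiv.Perm (Fin 12)) :
    ‖∑ j, (2 * ((τ j : ℕ) : ℝ) - 9) • vertexList φ j‖ ^ 2 ≤ 2288 + 3696 * φ := by
  have hy := sum_sq_antipodal_diff_le τ (fun j => (τ j : ℕ)) fun _ => rfl
  have hq := cross_term_le _ _ _ _ _ _ hy
  rw [norm_sq_sum_vertexList φ fun j => ((τ j : ℕ) : ℝ)]
  have hy' := (Int.cast_le (R := ℝ)).2 hy
  have hq' := (Int.cast_le (R := ℝ)).2 hq
  push_cast at hy' hq'
  generalize ((τ 11 : ℕ) : ℝ) - ((τ 0 : ℕ) : ℝ) = a at *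
  generalize ((τ 3 : ℕ) : ℝ) - ((τ 8 : ℕ) : ℝ) = b at *
  generalize ((τ 9 : ℕ) : ℝ) - ((τ 2 : ℕ) : ℝ) = c at *
  generalize ((τ 4 : ℕ) : ℝ) - ((τ 7 : ℕ) : ℝ) = d at *
  generalize ((τ 10 : ℕ) : ℝ) - ((τ 1 : ℕ) : ℝ) = e at *
  generalize ((τ 6 : ℕ) : ℝ) - ((τ 5 : ℕ) : ℝ) = f at *
  have hM : (a ^ 2 + b ^ 2 + c ^ 2 + d ^ 2 + e ^ 2 + f ^ 2) + 2 * (-a * b - c * d - e * f +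
      (c + d) * (e - f) + (a + b) * (c - d) + (e + f) * (a - b)) ≤ 924 := by linarith
  have heq : (c + d + φ * (e - f)) ^ 2 + (a + b + φ * (c - d)) ^ 2 + (e + f + φ * (a - b)) ^ 2 =
      2 * (a ^ 2 + b ^ 2 + c ^ 2 + d ^ 2 + e ^ 2 + f ^ 2) +
      φ * ((a ^ 2 + b ^ 2 + c ^ 2 + d ^ 2 + e ^ 2 + f ^ 2) + 2 * (-a * b - c * d - e * f +
      (c + d) * (e - f) + (a + b) * (c - d) + (e + f) * (a - b))) := by
    linear_combination ((e - f) ^ 2 + (c - d) ^ 2 + (a - b) ^ 2) * hφ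
  rw [heq]
  linarith [mul_le_mul_of_nonneg_left hM hpos.le]

theorem isGreatest_normSqSet_cycSet {φ : ℝ} (hφ : φ ^ 2 = φ + 1) (h₁ : 1.6 < φ) (h₂ : φ < 1.7) :
    IsGreatest (normSqSet (cycSet 1 φ) 12) (2288 + 3696 * φ) := by
  constructor
  · refine ⟨vertexList φ, vertexList_injective h₁ h₂, range_vertexList φ, ?_⟩
    have h : tupleAvg 12 (vertexList φ) =
        ∑ j, (2 * (((j : Fin 12) : ℕ) : ℝ) - 9) • vertexList φ j :=
      Finset.sum_congr rfl fun j _ => by congr 1; push_cast; ring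
    rw [h, norm_sq_sum_vertexList φ fun j => (j : ℕ)]
    norm_num [Fin.val_ofNat]
    linear_combination (-1680) * hφ
  · rintro _ ⟨v, hv, hrange, rfl⟩
    rw [← range_vertexList] at hrange
    have hex (i : Fin 12) : ∃ j, vertexList φ j = v i :=
      hrange.le (Set.mem_range_self i)
    choose σ hσ using hex
    have hinj : Function.Injective σ := fun i j h => hv (by rw [← hσ, ← hσ, h])
    let e : Equiv.Perm (Fin 12) := Equiv.ofBijective σ (Finite.injective_iff_bijective.1 hinj)
    have h : tupleAvg 12 v = ∑ j, (2 * ((e.symm j : ℕ) : ℝ) - 9) • vertexList φ j := by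
      rw [← Equiv.sum_comp e]
      refine Finset.sum_congr rfl fun i _ => ?_
      rw [Equiv.symm_apply_apply, ← hσ i]
      change _ • vertexList φ (σ i) = _ • vertexList φ (σ i)
      congr 1
      push_cast
      ring
    rw [h]
    exact norm_sq_sum_perm_le hφ (by linarith) e.symm

theorem tupleAvg_smul (N : ℕ) (r : ℝ) (v : Fin N → E3) :
    tupleAvg N (fun i => r • v i) = r • tupleAvg N v := by
  simp only [tupleAvg, Finset.smul_sum, smul_comm r]

theorem mul_mem_normSqSet_smul {𝒱 : Set E3} {N : ℕ} {r x : ℝ} (hr : r ≠ 0)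
    (hx : x ∈ normSqSet 𝒱 N) : r ^ 2 * x ∈ normSqSet (r • 𝒱) N := by
  obtain ⟨v, hv, rfl, rfl⟩ := hx
  refine ⟨fun i => r • v i, (smul_right_injective E3 hr).comp hv, Set.range_comp (r • ·) v, ?_⟩
  rw [tupleAvg_smul, norm_smul, mul_pow, Real.norm_eq_abs, sq_abs]

theorem IsGreatest.normSqSet_smul {𝒱 : Set E3} {N : ℕ} {r g : ℝ} (hr : r ≠ 0)
    (h : IsGreatest (normSqSet 𝒱 N) g) : IsGreatest (normSqSet (r • 𝒱) N) (r ^ 2 * g) := by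
  refine ⟨mul_mem_normSqSet_smul hr h.1, fun x hx => ?_⟩
  have hx' := h.2 (inv_smul_smul₀ hr 𝒱 ▸ mul_mem_normSqSet_smul (inv_ne_zero hr) hx)
  rwa [inv_pow, inv_mul_le_iff₀ (by positivity)] at hx'

theorem icosahedron_guesswork :
    IsGreatest (normSqSet icosahedron 12) (4136 + 1848 * Real.sqrt 5) ∧
    IsGreatest
      (normSqSet ((Real.sqrt ((5 + Real.sqrt 5) / 2))⁻¹ • icosahedron) 12)
      ((16544 + 7392 * Real.sqrt 5) / (10 + 2 * Real.sqrt 5)) ∧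
    |(1 / 2 : ℝ) * (12 + 1 -
        Real.sqrt ((16544 + 7392 * Real.sqrt 5) / (10 + 2 * Real.sqrt 5)) / 12) -
      4.5081| < 0.0001 := by
  have h5 : Real.sqrt 5 ^ 2 = 5 := Real.sq_sqrt (by norm_num)
  have h5lo : 2.23606 < Real.sqrt 5 := Real.lt_sqrt_of_sq_lt (by norm_num)
  have h5hi : Real.sqrt 5 < 2.23607 := (Real.sqrt_lt' (by norm_num)).2 (by norm_num)
  have hmax : IsGreatest (normSqSet icosahedron 12) (4136 + 1848 * Real.sqrt 5) := by
    have h := isGreatest_normSqSet_cycSet (φ := (1 + Real.sqrt 5) / 2)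
      (by linear_combination h5 / 4) (by linarith) (by linarith)
    rwa [show 2288 + 3696 * ((1 + Real.sqrt 5) / 2) = 4136 + 1848 * Real.sqrt 5 by ring] at h
  refine ⟨hmax, ?_, ?_⟩
  · have hr : (Real.sqrt ((5 + Real.sqrt 5) / 2))⁻¹ ≠ 0 :=
      inv_ne_zero (Real.sqrt_pos.2 (by positivity)).ne'
    convert hmax.normSqSet_smul hr using 1
    rw [inv_pow, Real.sq_sqrt (by positivity)]
    field_simp
    ring
  · set g := (16544 + 7392 * Real.sqrt 5) / (10 + 2 * Real.sqrt 5) with hg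
    have hpos : 0 < 10 + 2 * Real.sqrt 5 := by positivity
    have hglo : 47.804 < Real.sqrt g := by
      refine Real.lt_sqrt_of_sq_lt ?_
      rw [hg, lt_div_iff₀ hpos]
      linarith
    have hghi : Real.sqrt g < 47.806 := by
      rw [Real.sqrt_lt' (by norm_num), hg, div_lt_iff₀ hpos]
      linarith
    rw [abs_lt]
    constructor <;> linarith
end
end

section
/- Let φ = (1+√5)/2 and let 𝒱 ⊂ ℝ³ be the set of the N = 20 vertices of the regular dodecahedron: the eight vectors (±1,±1,±1) together with all cyclic permutations of the coordinates of (0,±1/φ,±φ). Then max_{v ∈ 𝒱^N̲} |⟨v⟩|₂² = 26568 + 11864√5. Consequently, for the unit-normalized ensemble 𝒱/√3 one has g = (106272 + 47456√5)/12, and its minimum guesswork is (1/2)·(21 − √g/20) ≈ 7.1741. -/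
open Pointwise

noncomputable section

/-- The vertices of the regular dodecahedron: the eight vectors `(±1, ±1, ±1)` together
with all cyclic permutations of `(0, ±1/φ, ±φ)`, where `φ = (1 + √5)/2`. -/
def dodecahedron : Set E3 :=
  {v | ∃ s : Fin 3 → ℝ, (∀ i, s i = 1 ∨ s i = -1) ∧
       v = (WithLp.equiv 2 (Fin 3 → ℝ)).symm s} ∪
  cycSet (((1 + Real.sqrt 5) / 2)⁻¹) ((1 + Real.sqrt 5) / 2)


/-- The ring homomorphism `ℤ[√5] → ℝ`. -/
def sqrtFiveHom : ℤ√5 →+* ℝ :=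
  Zsqrtd.lift ⟨Real.sqrt 5, by norm_num⟩

lemma sqrtFiveHom_apply (a : ℤ√5) : sqrtFiveHom a = a.re + a.im * Real.sqrt 5 := rfl

lemma sqrtFiveHom_injective : Function.Injective sqrtFiveHom := by
  refine Zsqrtd.lift_injective ⟨Real.sqrt 5, by norm_num⟩ fun n hn => ?_
  have h1 : n < 3 := by nlinarith
  have h2 : -3 < n := by nlinarith
  interval_cases n <;> omega

/-- A computable test for nonnegativity of `a.re + a.im * √5`. -/
def nonnegTest (a : ℤ√5) : Bool :=
  if 0 ≤ a.re then decide (0 ≤ a.im) || decide (5 * (a.im * a.im) ≤ a.re * a.re)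
  else decide (0 ≤ a.im) && decide (a.re * a.re ≤ 5 * (a.im * a.im))

lemma nonneg_of_nonnegTest {a : ℤ√5} (h : nonnegTest a = true) : 0 ≤ sqrtFiveHom a := by
  have h5 : Real.sqrt 5 * Real.sqrt 5 = 5 := Real.mul_self_sqrt (by norm_num)
  have h0 : 0 ≤ Real.sqrt 5 := Real.sqrt_nonneg 5
  rw [sqrtFiveHom_apply]
  unfold nonnegTest at h
  split_ifs at h with hre
  · have hre' : (0 : ℝ) ≤ a.re := by exact_mod_cast hre
    rcases Bool.or_eq_true_iff.mp h with h | h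
    · have him : (0 : ℝ) ≤ a.im := by exact_mod_cast of_decide_eq_true h
      positivity
    · have hsq : 5 * ((a.im : ℝ) * a.im) ≤ a.re * a.re := by
        exact_mod_cast of_decide_eq_true h
      have := abs_le_of_sq_le_sq' (a := (a.im : ℝ) * Real.sqrt 5) (b := a.re)
        (by nlinarith) hre'
      linarith [this.1]
  · obtain ⟨h1, h2⟩ := (Bool.and_eq_true_iff).mp h
    have him : (0 : ℝ) ≤ a.im := by exact_mod_cast of_decide_eq_true h1
    have hsq : (a.re : ℝ) * a.re ≤ 5 * (a.im * a.im) := by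
      exact_mod_cast of_decide_eq_true h2
    have := abs_le_of_sq_le_sq' (a := (a.re : ℝ)) (b := a.im * Real.sqrt 5)
      (by nlinarith) (by positivity)
    linarith [this.1]

/-- Vectors with coordinates in `ℤ[√5]`. -/
abbrev ZVec := (ℤ√5) × (ℤ√5) × (ℤ√5)

def zdot (d r : ZVec) : ℤ√5 := d.1 * r.1 + d.2.1 * r.2.1 + d.2.2 * r.2.2

def zscale (a : ℤ√5) (r : ZVec) : ZVec := (a * r.1, a * r.2.1, a * r.2.2)

/-- The linear functional on `ℝ³` with coefficient vector `d`. -/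
def evalAt (d : ZVec) (u : ℝ × ℝ × ℝ) : ℝ :=
  sqrtFiveHom d.1 * u.1 + sqrtFiveHom d.2.1 * u.2.1 + sqrtFiveHom d.2.2 * u.2.2

def toRealVec (r : ZVec) : ℝ × ℝ × ℝ :=
  (sqrtFiveHom r.1, sqrtFiveHom r.2.1, sqrtFiveHom r.2.2)

lemma evalAt_add (d e : ZVec) (u : ℝ × ℝ × ℝ) :
    evalAt (d + e) u = evalAt d u + evalAt e u := by
  simp only [evalAt, Prod.fst_add, Prod.snd_add, map_add]; ring

lemma evalAt_sub (d e : ZVec) (u : ℝ × ℝ × ℝ) :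
    evalAt (d - e) u = evalAt d u - evalAt e u := by
  simp only [evalAt, Prod.fst_sub, Prod.snd_sub, map_sub]; ring

lemma evalAt_neg (d : ZVec) (u : ℝ × ℝ × ℝ) : evalAt (-d) u = -evalAt d u := by
  simp only [evalAt, Prod.fst_neg, Prod.snd_neg, map_neg]; ring

lemma evalAt_sq_le (d : ZVec) (u : ℝ × ℝ × ℝ) :
    evalAt d u ^ 2 ≤ sqrtFiveHom (zdot d d) * (u.1 ^ 2 + u.2.1 ^ 2 + u.2.2 ^ 2) := by
  simp only [evalAt, zdot, map_add, map_mul]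
  nlinarith [sq_nonneg (sqrtFiveHom d.1 * u.2.1 - sqrtFiveHom d.2.1 * u.1),
    sq_nonneg (sqrtFiveHom d.1 * u.2.2 - sqrtFiveHom d.2.2 * u.1),
    sq_nonneg (sqrtFiveHom d.2.1 * u.2.2 - sqrtFiveHom d.2.2 * u.2.1)]

/-- `u` lies in the convex cone spanned by `r₁`, `r₂`, `r₃`. -/
def InCone (r₁ r₂ r₃ : ZVec) (u : ℝ × ℝ × ℝ) : Prop :=
  ∃ a b c : ℝ, 0 ≤ a ∧ 0 ≤ b ∧ 0 ≤ c ∧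
    u = a • toRealVec r₁ + b • toRealVec r₂ + c • toRealVec r₃

lemma InCone.rotate {r₁ r₂ r₃ : ZVec} {u : ℝ × ℝ × ℝ} (h : InCone r₁ r₂ r₃ u) :
    InCone r₂ r₃ r₁ u := by
  obtain ⟨a, b, c, ha, hb, hc, rfl⟩ := h
  exact ⟨b, c, a, hb, hc, ha, by abel⟩

lemma toRealVec_zscale_add (α β : ℤ√5) (r s : ZVec) :
    toRealVec (zscale α r + zscale β s) =
      sqrtFiveHom α • toRealVec r + sqrtFiveHom β • toRealVec s := by
  simp [toRealVec, zscale]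

/-- Subdividing a cone at a point of the edge from `r₁` to `r₂`. -/
lemma InCone.split {r₁ r₂ r₃ : ZVec} {u : ℝ × ℝ × ℝ} (h : InCone r₁ r₂ r₃ u) {α β : ℤ√5}
    (hα : 0 < sqrtFiveHom α) (hβ : 0 < sqrtFiveHom β) :
    InCone r₁ (zscale α r₁ + zscale β r₂) r₃ u ∨
      InCone (zscale α r₁ + zscale β r₂) r₂ r₃ u := by
  obtain ⟨a, b, c, ha, hb, hc, rfl⟩ := h
  simp only [InCone, toRealVec_zscale_add]
  set x := sqrtFiveHom α
  set y := sqrtFiveHom β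
  rcases le_total (a * y) (b * x) with hab | hab
  · refine Or.inr ⟨a / x, b - a / x * y, c, by positivity, ?_, hc, ?_⟩
    · rw [sub_nonneg, div_mul_eq_mul_div, div_le_iff₀ hα]; exact hab
    · have : a / x * x = a := by field_simp
      rw [smul_add, smul_smul, smul_smul, this]
      module
  · refine Or.inl ⟨a - b / y * x, b / y, c, ?_, by positivity, hc, ?_⟩
    · rw [sub_nonneg, div_mul_eq_mul_div, div_le_iff₀ hβ]; exact hab
    · have : b / y * y = b := by field_simp
      rw [smul_add, smul_smul, smul_smul, this]
      module

def coneNonneg (r₁ r₂ r₃ d : ZVec) : Bool :=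
  nonnegTest (zdot d r₁) && nonnegTest (zdot d r₂) && nonnegTest (zdot d r₃)

lemma evalAt_nonneg_of_coneNonneg {r₁ r₂ r₃ d : ZVec} {u : ℝ × ℝ × ℝ}
    (h : coneNonneg r₁ r₂ r₃ d = true) (hu : InCone r₁ r₂ r₃ u) : 0 ≤ evalAt d u := by
  obtain ⟨a, b, c, ha, hb, hc, rfl⟩ := hu
  simp only [coneNonneg, Bool.and_eq_true] at h
  obtain ⟨⟨h₁, h₂⟩, h₃⟩ := h
  have key : evalAt d (a • toRealVec r₁ + b • toRealVec r₂ + c • toRealVec r₃) =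
      a * sqrtFiveHom (zdot d r₁) + b * sqrtFiveHom (zdot d r₂) +
        c * sqrtFiveHom (zdot d r₃) := by
    simp only [evalAt, toRealVec, zdot, map_add, map_mul, Prod.fst_add, Prod.snd_add,
      Prod.smul_fst, Prod.smul_snd, smul_eq_mul]
    ring
  rw [key]
  have := nonneg_of_nonnegTest h₁
  have := nonneg_of_nonnegTest h₂
  have := nonneg_of_nonnegTest h₃
  positivity

/-- Splits `ds` into the sum of those vectors whose sign is constant on the cone (with that sign,
added to `W`), and the list of the remaining ones. -/
def settle (r₁ r₂ r₃ : ZVec) : List ZVec → ZVec → List ZVec → ZVec × List ZVec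
  | [], W, acc => (W, acc)
  | d :: ds, W, acc =>
    if coneNonneg r₁ r₂ r₃ d then settle r₁ r₂ r₃ ds (W + d) acc
    else if coneNonneg r₁ r₂ r₃ (-d) then settle r₁ r₂ r₃ ds (W - d) acc
    else settle r₁ r₂ r₃ ds W (d :: acc)

/-- The sum of the absolute values of the functionals in `ds` at `u`. -/
def absSum (ds : List ZVec) (u : ℝ × ℝ × ℝ) : ℝ := (ds.map fun d => |evalAt d u|).sum

lemma absSum_cons (d : ZVec) (ds : List ZVec) (u : ℝ × ℝ × ℝ) :
    absSum (d :: ds) u = |evalAt d u| + absSum ds u := by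
  simp [absSum]

lemma settle_spec {r₁ r₂ r₃ : ZVec} {u : ℝ × ℝ × ℝ} (hu : InCone r₁ r₂ r₃ u)
    (ds : List ZVec) (W : ZVec) (acc : List ZVec) :
    evalAt (settle r₁ r₂ r₃ ds W acc).1 u + absSum (settle r₁ r₂ r₃ ds W acc).2 u =
      evalAt W u + absSum ds u + absSum acc u := by
  induction ds generalizing W acc with
  | nil => simp [settle, absSum]
  | cons d ds ih =>
    rw [settle, absSum_cons]
    split_ifs with h₁ h₂
    · rw [ih, evalAt_add, abs_of_nonneg (evalAt_nonneg_of_coneNonneg h₁ hu)]; ring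
    · have := evalAt_nonneg_of_coneNonneg h₂ hu
      rw [evalAt_neg] at this
      rw [ih, evalAt_sub, abs_of_nonpos (by linarith)]; ring
    · rw [ih, absSum_cons]; ring

/-- Checks that all the signed sums `W ± d₁ ± d₂ ± …` have squared norm at most `M`. -/
def branchCheck (M : ℤ√5) : List ZVec → ZVec → Bool
  | [], W => nonnegTest (M - zdot W W)
  | d :: ds, W => branchCheck M ds (W + d) && branchCheck M ds (W - d)

lemma branchCheck_sound {M : ℤ√5} {ds : List ZVec} {W : ZVec}
    (h : branchCheck M ds W = true) (u : ℝ × ℝ × ℝ) :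
    evalAt W u + absSum ds u ≤
      Real.sqrt (sqrtFiveHom M * (u.1 ^ 2 + u.2.1 ^ 2 + u.2.2 ^ 2)) := by
  induction ds generalizing W with
  | nil =>
    have := nonneg_of_nonnegTest h
    rw [map_sub] at this
    simp only [absSum, List.map_nil, List.sum_nil, add_zero]
    refine Real.le_sqrt_of_sq_le ((evalAt_sq_le W u).trans ?_)
    gcongr
    linarith
  | cons d ds ih =>
    simp only [branchCheck, Bool.and_eq_true] at h
    have h₁ := ih h.1
    have h₂ := ih h.2
    rw [evalAt_add] at h₁
    rw [evalAt_sub] at h₂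
    rw [absSum_cons]
    rcases abs_cases (evalAt d u) with ⟨h, -⟩ | ⟨h, -⟩ <;> rw [h] <;> linarith

/-- A recipe for the iterated subdivision of a simplicial cone: `split α β` cuts the edge from the
first to the second ray at `α r₁ + β r₂`, and `rot` rotates the rays. -/
inductive ConeTree
  | leaf : ConeTree
  | rot : ConeTree → ConeTree
  | split : ℤ√5 → ℤ√5 → ConeTree → ConeTree → ConeTree

def strictTest (a : ℤ√5) : Bool := nonnegTest a && !decide (a = 0)

lemma pos_of_strictTest {a : ℤ√5} (h : strictTest a = true) : 0 < sqrtFiveHom a := by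
  simp only [strictTest, Bool.and_eq_true, Bool.not_eq_true', decide_eq_false_iff_not] at h
  refine lt_of_le_of_ne (nonneg_of_nonnegTest h.1) fun h0 => h.2 ?_
  exact sqrtFiveHom_injective (h0.symm.trans (map_zero sqrtFiveHom).symm)

def treeCheck (M : ℤ√5) : ConeTree → ZVec → ZVec → ZVec → ZVec × List ZVec → Bool
  | .leaf, r₁, r₂, r₃, (W, ds) =>
    let p := settle r₁ r₂ r₃ ds W []
    branchCheck M p.2 p.1
  | .rot t, r₁, r₂, r₃, p => treeCheck M t r₂ r₃ r₁ p
  | .split α β s t, r₁, r₂, r₃, (W, ds) =>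
    strictTest α && strictTest β &&
      treeCheck M s r₁ (zscale α r₁ + zscale β r₂) r₃ (settle r₁ r₂ r₃ ds W []) &&
      treeCheck M t (zscale α r₁ + zscale β r₂) r₂ r₃ (settle r₁ r₂ r₃ ds W [])

lemma treeCheck_sound {M : ℤ√5} {t : ConeTree} {r₁ r₂ r₃ : ZVec} {p : ZVec × List ZVec}
    (h : treeCheck M t r₁ r₂ r₃ p = true) {u : ℝ × ℝ × ℝ} (hu : InCone r₁ r₂ r₃ u) :
    evalAt p.1 u + absSum p.2 u ≤
      Real.sqrt (sqrtFiveHom M * (u.1 ^ 2 + u.2.1 ^ 2 + u.2.2 ^ 2)) := by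
  induction t generalizing r₁ r₂ r₃ p with
  | leaf =>
    obtain ⟨W, ds⟩ := p
    have := branchCheck_sound h u
    rw [settle_spec hu] at this
    simpa [absSum] using this
  | rot t ih => exact ih h hu.rotate
  | split α β s t ihs iht =>
    obtain ⟨W, ds⟩ := p
    simp only [treeCheck, Bool.and_eq_true] at h
    obtain ⟨⟨⟨hα, hβ⟩, hs⟩, ht⟩ := h
    have key : evalAt (settle r₁ r₂ r₃ ds W []).1 u + absSum (settle r₁ r₂ r₃ ds W []).2 u ≤
        Real.sqrt (sqrtFiveHom M * (u.1 ^ 2 + u.2.1 ^ 2 + u.2.2 ^ 2)) :=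
      (hu.split (pos_of_strictTest hα) (pos_of_strictTest hβ)).elim (ihs hs) (iht ht)
    rw [settle_spec hu] at key
    simpa [absSum] using key

/-- Representatives of the ten antipodal pairs of vertices, scaled by `2`. -/
def halfTable : List ZVec :=
  [(2, 2, 2), (2, 2, -2), (2, -2, 2), (-2, 2, 2),
   (0, ⟨-1, 1⟩, ⟨1, 1⟩), (0, ⟨1, -1⟩, ⟨1, 1⟩),
   (⟨-1, 1⟩, ⟨1, 1⟩, 0), (⟨1, -1⟩, ⟨1, 1⟩, 0),
   (⟨1, 1⟩, 0, ⟨-1, 1⟩), (⟨1, 1⟩, 0, ⟨1, -1⟩)]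

/-- Each vector of the list together with the sums and differences of all the pairs. -/
def sumsAndDiffs : List ZVec → List ZVec
  | [] => []
  | a :: l => a :: (l.map (a + ·) ++ l.map (a - ·) ++ sumsAndDiffs l)

def octantTree : ConeTree :=
  open ConeTree in
  (split ⟨1, 1⟩ ⟨2, 0⟩ (rot (rot (split ⟨1, 1⟩ ⟨2, 0⟩ (rot (rot (split ⟨1, 0⟩ ⟨4, 0⟩ (rot (rot
  (split ⟨1, 0⟩ ⟨1, 0⟩ (split ⟨2, 0⟩ ⟨-1, 1⟩ leaf (rot (split ⟨3, -1⟩ ⟨2, 0⟩ leaf leaf))) (rot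
  (split ⟨-1, 1⟩ ⟨2, 0⟩ (split ⟨-1, 1⟩ ⟨1, 0⟩ (rot (rot (split ⟨2, 0⟩ ⟨-1, 1⟩ leaf (rot (split
  ⟨3, -1⟩ ⟨1, 0⟩ (rot (rot (split ⟨1, 0⟩ ⟨2, 0⟩ leaf leaf))) leaf))))) leaf) leaf))))) (split
  ⟨1, 0⟩ ⟨2, 2⟩ (split ⟨2, 0⟩ ⟨-1, 1⟩ leaf leaf) (rot (split ⟨4, 0⟩ ⟨1, 0⟩ (rot (rot (split ⟨1,
  0⟩ ⟨2, 2⟩ leaf leaf))) leaf)))))) (split ⟨1, 0⟩ ⟨2, 2⟩ (rot (rot (split ⟨1, 0⟩ ⟨1, 0⟩ (rot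
  (rot (split ⟨-2, 1⟩ ⟨1, 0⟩ (rot (split ⟨-1, 1⟩ ⟨2, 0⟩ leaf leaf)) (rot (split ⟨2, 0⟩ ⟨-1, 1⟩
  leaf leaf))))) (rot (split ⟨1, 0⟩ ⟨-2, 1⟩ (rot (rot (split ⟨-1, 1⟩ ⟨2, 0⟩ leaf leaf))) (rot
  (rot (split ⟨2, 0⟩ ⟨-1, 1⟩ leaf leaf)))))))) (rot (split ⟨4, 0⟩ ⟨1, 0⟩ (rot (split ⟨2, 0⟩ ⟨-1,
  1⟩ leaf leaf)) (rot (split ⟨1, 0⟩ ⟨-2, 1⟩ leaf leaf)))))))) (rot (split ⟨3, -1⟩ ⟨2, 0⟩ (split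
  ⟨-2, 2⟩ ⟨1, 0⟩ (rot (rot (split ⟨1, 0⟩ ⟨2, 2⟩ (rot (rot (split ⟨1, 0⟩ ⟨1, 0⟩ (rot (rot (split
  ⟨-2, 1⟩ ⟨1, 0⟩ (rot (split ⟨-1, 1⟩ ⟨2, 0⟩ leaf leaf)) (rot (split ⟨2, 0⟩ ⟨-1, 1⟩ leaf
  leaf))))) (rot (split ⟨1, 0⟩ ⟨-2, 1⟩ (rot (rot (split ⟨-1, 1⟩ ⟨2, 0⟩ leaf leaf))) (rot (rot
  (split ⟨2, 0⟩ ⟨-1, 1⟩ leaf leaf)))))))) (rot (split ⟨4, 0⟩ ⟨1, 0⟩ (rot (split ⟨2, 0⟩ ⟨-1, 1⟩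
  leaf leaf)) (rot (split ⟨1, 0⟩ ⟨-2, 1⟩ leaf leaf))))))) (rot (split ⟨1, 1⟩ ⟨2, 0⟩ (split ⟨3,
  1⟩ ⟨1, 0⟩ (rot (rot (split ⟨1, 0⟩ ⟨1, 0⟩ (rot (rot (split ⟨3, -1⟩ ⟨4, 0⟩ leaf leaf))) (rot
  (rot (split ⟨1, 0⟩ ⟨2, 0⟩ leaf leaf)))))) (rot (split ⟨3, -1⟩ ⟨4, 0⟩ (rot (split ⟨1, 0⟩ ⟨2, 0⟩
  leaf leaf)) (rot (split ⟨4, 0⟩ ⟨3, -1⟩ leaf leaf))))) (rot (split ⟨1, 0⟩ ⟨1, 0⟩ (split ⟨2, 0⟩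
  ⟨-1, 1⟩ (rot (rot (split ⟨3, -1⟩ ⟨4, 0⟩ leaf leaf))) (rot (rot (split ⟨1, 0⟩ ⟨1, 0⟩ leaf
  leaf)))) (split ⟨-1, 1⟩ ⟨2, 0⟩ (rot (split ⟨1, 0⟩ ⟨1, 0⟩ leaf leaf)) (rot (split ⟨4, 0⟩ ⟨3,
  -1⟩ leaf leaf)))))))) (rot (split ⟨4, 0⟩ ⟨1, 0⟩ (split ⟨2, 2⟩ ⟨1, 0⟩ (split ⟨2, 2⟩ ⟨1, 0⟩ leaf
  leaf) (rot (split ⟨-1, 1⟩ ⟨2, 0⟩ (rot (rot (split ⟨-1, 1⟩ ⟨2, 0⟩ leaf leaf))) (rot (split ⟨2,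
  0⟩ ⟨-1, 1⟩ leaf leaf))))) (rot (split ⟨-1, 1⟩ ⟨2, 0⟩ (rot (rot (split ⟨2, 0⟩ ⟨-1, 1⟩ leaf
  (split ⟨1, 0⟩ ⟨2, 0⟩ leaf (rot (split ⟨-1, 1⟩ ⟨1, 0⟩ leaf leaf)))))) (rot (split ⟨2, 0⟩ ⟨-1,
  1⟩ (rot (rot (split ⟨1, 0⟩ ⟨1, 1⟩ leaf leaf))) leaf)))))))))

lemma treeCheck_octants : ∀ b ∈ [1, (-1 : ℤ√5)], ∀ c ∈ [1, (-1 : ℤ√5)],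
    treeCheck ⟨26568, 11864⟩ octantTree (1, 0, 0) (0, b, 0) (0, 0, c)
      (0, sumsAndDiffs halfTable) = true := by
  decide +kernel

lemma absSum_sumsAndDiffs (l : List ZVec) (u : ℝ × ℝ × ℝ) :
    (l.map fun a => (l.map fun b => |evalAt a u - evalAt b u| + |evalAt a u + evalAt b u|).sum).sum
      = 2 * absSum (sumsAndDiffs l) u := by
  induction l with
  | nil => simp [sumsAndDiffs, absSum]
  | cons a l ih =>
    have h₁ : (l.map fun b => |evalAt b u - evalAt a u| + |evalAt b u + evalAt a u|).sum =
        (l.map fun b => |evalAt a u - evalAt b u| + |evalAt a u + evalAt b u|).sum := by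
      congr 2; funext b; rw [abs_sub_comm, add_comm (evalAt a u)]
    have h₂ : (l.map fun b => |evalAt a u - evalAt b u| + |evalAt a u + evalAt b u|).sum =
        absSum (l.map (a + ·) ++ l.map (a - ·)) u := by
      simp only [absSum, List.map_append, List.sum_append, List.map_map, List.sum_map_add]
      rw [add_comm]
      congr 3 <;> funext b <;> simp [evalAt_add, evalAt_sub]
    have h₃ : absSum (sumsAndDiffs (a :: l)) u = |evalAt a u| +
        (absSum (l.map (a + ·) ++ l.map (a - ·)) u + absSum (sumsAndDiffs l) u) := by
      simp [sumsAndDiffs, absSum, add_assoc]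
    have h₄ : |evalAt a u - evalAt a u| + |evalAt a u + evalAt a u| = 2 * |evalAt a u| := by
      rw [sub_self, abs_zero, zero_add, ← two_mul, abs_mul, abs_two]
    simp only [List.map_cons, List.sum_cons, List.sum_map_add (f := fun b => |_| + |_|)] at ih ⊢
    rw [ih, h₁, h₂, h₃, h₄]
    ring

lemma inCone_octant {x : ℝ} (hx : 0 ≤ x) (y z : ℝ) : ∃ b ∈ [1, (-1 : ℤ√5)],
    ∃ c ∈ [1, (-1 : ℤ√5)], InCone (1, 0, 0) (0, b, 0) (0, 0, c) (x, y, z) := by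
  have key : ∀ t : ℝ, ∃ a ∈ [1, (-1 : ℤ√5)], |t| * sqrtFiveHom a = t := by
    intro t
    rcases abs_cases t with ⟨h, -⟩ | ⟨h, -⟩
    · exact ⟨1, by simp, by simp [h]⟩
    · exact ⟨-1, by simp, by simp [h]⟩
  obtain ⟨b, hb, hy⟩ := key y
  obtain ⟨c, hc, hz⟩ := key z
  refine ⟨b, hb, c, hc, x, |y|, |z|, hx, abs_nonneg _, abs_nonneg _, ?_⟩
  simp [toRealVec, hy, hz]

lemma absSum_neg (ds : List ZVec) (u : ℝ × ℝ × ℝ) : absSum ds (-u) = absSum ds u := by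
  have h : ∀ d, evalAt d (-u) = -evalAt d u := by
    intro d
    simp only [evalAt, Prod.fst_neg, Prod.snd_neg]
    ring
  simp only [absSum, h, abs_neg]

lemma absSum_le (u : ℝ × ℝ × ℝ) : absSum (sumsAndDiffs halfTable) u ≤
    Real.sqrt ((26568 + 11864 * Real.sqrt 5) * (u.1 ^ 2 + u.2.1 ^ 2 + u.2.2 ^ 2)) := by
  wlog hu : 0 ≤ u.1 generalizing u
  · simpa [absSum_neg] using this (-u) (by simpa using (not_le.mp hu).le)
  obtain ⟨x, y, z⟩ := u
  obtain ⟨b, hb, c, hc, h⟩ := inCone_octant hu y z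
  simpa [evalAt, sqrtFiveHom_apply] using treeCheck_sound (treeCheck_octants b hb c hc) h

/-- The vertices of the dodecahedron, indexed so that antipodal vertices share an index. -/
def vertex : Fin halfTable.length ⊕ Fin halfTable.length → E3
  | .inl i => (2⁻¹ : ℝ) • vec3 (sqrtFiveHom halfTable[i].1) (sqrtFiveHom halfTable[i].2.1)
      (sqrtFiveHom halfTable[i].2.2)
  | .inr i => (2⁻¹ : ℝ) • vec3 (sqrtFiveHom (-halfTable[i].1)) (sqrtFiveHom (-halfTable[i].2.1))
      (sqrtFiveHom (-halfTable[i].2.2))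

def vertexZ : Fin halfTable.length ⊕ Fin halfTable.length → ZVec
  | .inl i => halfTable[i]
  | .inr i => -halfTable[i]

lemma vec3_apply (a b c : ℝ) (i : Fin 3) : vec3 a b c i = ![a, b, c] i := rfl

lemma vertex_eq (k) : vertex k = (2⁻¹ : ℝ) • vec3 (sqrtFiveHom (vertexZ k).1)
    (sqrtFiveHom (vertexZ k).2.1) (sqrtFiveHom (vertexZ k).2.2) := by
  cases k <;> rfl

lemma vertexZ_injective : Function.Injective vertexZ := by
  decide +kernel

lemma vertex_injective : Function.Injective vertex := by
  intro k l h
  rw [vertex_eq, vertex_eq] at h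
  have h' := smul_right_injective E3 (by norm_num : (2⁻¹ : ℝ) ≠ 0) h
  apply vertexZ_injective
  have h0 := congrArg (fun v : E3 => v 0) h'
  have h1 := congrArg (fun v : E3 => v 1) h'
  have h2 := congrArg (fun v : E3 => v 2) h'
  simp only [vec3_apply] at h0 h1 h2
  exact Prod.ext (sqrtFiveHom_injective h0)
    (Prod.ext (sqrtFiveHom_injective h1) (sqrtFiveHom_injective h2))

lemma inner_vertex (k) (w : E3) :
    inner ℝ (vertex k) w = 2⁻¹ * evalAt (vertexZ k) (w 0, w 1, w 2) := by
  rw [vertex_eq, real_inner_smul_left]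
  congr 1
  simp [PiLp.inner_apply, Fin.sum_univ_three, vec3_apply, evalAt, mul_comm]

lemma phi_inv : ((1 + Real.sqrt 5) / 2)⁻¹ = (Real.sqrt 5 - 1) / 2 := by
  have h5 : Real.sqrt 5 * Real.sqrt 5 = 5 := Real.mul_self_sqrt (by norm_num)
  have h0 : 0 ≤ Real.sqrt 5 := Real.sqrt_nonneg 5
  rw [inv_eq_iff_eq_inv, eq_comm, inv_eq_of_mul_eq_one_left]
  linarith [h5]

lemma vec3_cyc (x y s t : ℝ) (c : Fin 3) :
    (WithLp.equiv 2 (Fin 3 → ℝ)).symm (fun i => ![0, s * x, t * y] (i + c)) =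
      ![vec3 0 (s * x) (t * y), vec3 (s * x) (t * y) 0, vec3 (t * y) 0 (s * x)] c := by
  fin_cases c <;> ext i <;> fin_cases i <;> rfl

lemma vec3_eta (s : Fin 3 → ℝ) :
    (WithLp.equiv 2 (Fin 3 → ℝ)).symm s = vec3 (s 0) (s 1) (s 2) := by
  ext i; fin_cases i <;> rfl

lemma smul_vec3 (r a b c : ℝ) : r • vec3 a b c = vec3 (r * a) (r * b) (r * c) := by
  ext i; fin_cases i <;> rfl

lemma vec3_mem_dodecahedron_of_signs {a b c : ℝ} (ha : a = 1 ∨ a = -1) (hb : b = 1 ∨ b = -1)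
    (hc : c = 1 ∨ c = -1) : vec3 a b c ∈ dodecahedron := by
  refine Or.inl ⟨![a, b, c], fun i => ?_, rfl⟩
  fin_cases i <;> assumption

lemma vec3_cyc_mem_dodecahedron {s t : ℝ} (c : Fin 3) (hs : s = 1 ∨ s = -1)
    (ht : t = 1 ∨ t = -1) :
    ![vec3 0 (s * ((Real.sqrt 5 - 1) / 2)) (t * ((1 + Real.sqrt 5) / 2)),
      vec3 (s * ((Real.sqrt 5 - 1) / 2)) (t * ((1 + Real.sqrt 5) / 2)) 0,
      vec3 (t * ((1 + Real.sqrt 5) / 2)) 0 (s * ((Real.sqrt 5 - 1) / 2))] c ∈ dodecahedron := by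
  refine Or.inr ⟨c, s, t, hs, ht, ?_⟩
  rw [phi_inv, vec3_cyc]

lemma vertex_eq_vec3 (k) : vertex k = vec3 (2⁻¹ * sqrtFiveHom (vertexZ k).1)
    (2⁻¹ * sqrtFiveHom (vertexZ k).2.1) (2⁻¹ * sqrtFiveHom (vertexZ k).2.2) := by
  rw [vertex_eq, smul_vec3]

lemma vec3_congr {a b c a' b' c' : ℝ} (ha : a = a') (hb : b = b') (hc : c = c') :
    vec3 a b c = vec3 a' b' c' := by
  rw [ha, hb, hc]

lemma exists_vertex_eq_of_signs {a b c : ℝ} (ha : a = 1 ∨ a = -1) (hb : b = 1 ∨ b = -1)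
    (hc : c = 1 ∨ c = -1) : ∃ k, vertex k = vec3 a b c := by
  rcases ha with rfl | rfl <;> rcases hb with rfl | rfl <;> rcases hc with rfl | rfl
  on_goal 1 => refine ⟨.inl (0 : Fin 10), ?_⟩
  on_goal 2 => refine ⟨.inl (1 : Fin 10), ?_⟩
  on_goal 3 => refine ⟨.inl (2 : Fin 10), ?_⟩
  on_goal 4 => refine ⟨.inr (3 : Fin 10), ?_⟩
  on_goal 5 => refine ⟨.inl (3 : Fin 10), ?_⟩
  on_goal 6 => refine ⟨.inr (2 : Fin 10), ?_⟩
  on_goal 7 => refine ⟨.inr (1 : Fin 10), ?_⟩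
  on_goal 8 => refine ⟨.inr (0 : Fin 10), ?_⟩
  all_goals
    rw [vertex_eq_vec3]
    apply vec3_congr <;> simp [vertexZ, halfTable, sqrtFiveHom_apply]

lemma exists_vertex_eq_of_cyc {s t : ℝ} (c : Fin 3) (hs : s = 1 ∨ s = -1)
    (ht : t = 1 ∨ t = -1) :
    ∃ k, vertex k =
      ![vec3 0 (s * ((Real.sqrt 5 - 1) / 2)) (t * ((1 + Real.sqrt 5) / 2)),
        vec3 (s * ((Real.sqrt 5 - 1) / 2)) (t * ((1 + Real.sqrt 5) / 2)) 0,
        vec3 (t * ((1 + Real.sqrt 5) / 2)) 0 (s * ((Real.sqrt 5 - 1) / 2))] c := by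
  fin_cases c <;> rcases hs with rfl | rfl <;> rcases ht with rfl | rfl
  on_goal 1 => refine ⟨.inl (4 : Fin 10), ?_⟩
  on_goal 2 => refine ⟨.inr (5 : Fin 10), ?_⟩
  on_goal 3 => refine ⟨.inl (5 : Fin 10), ?_⟩
  on_goal 4 => refine ⟨.inr (4 : Fin 10), ?_⟩
  on_goal 5 => refine ⟨.inl (6 : Fin 10), ?_⟩
  on_goal 6 => refine ⟨.inr (7 : Fin 10), ?_⟩
  on_goal 7 => refine ⟨.inl (7 : Fin 10), ?_⟩
  on_goal 8 => refine ⟨.inr (6 : Fin 10), ?_⟩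
  on_goal 9 => refine ⟨.inl (8 : Fin 10), ?_⟩
  on_goal 10 => refine ⟨.inr (9 : Fin 10), ?_⟩
  on_goal 11 => refine ⟨.inl (9 : Fin 10), ?_⟩
  on_goal 12 => refine ⟨.inr (8 : Fin 10), ?_⟩
  all_goals
    rw [vertex_eq_vec3]
    apply vec3_congr <;> simp [vertexZ, halfTable, sqrtFiveHom_apply] <;> ring

lemma vertex_mem_dodecahedron (k) : vertex k ∈ dodecahedron := by
  have h1 : (1 : ℝ) = 1 ∨ (1 : ℝ) = -1 := Or.inl rfl
  have h2 : (-1 : ℝ) = 1 ∨ (-1 : ℝ) = -1 := Or.inr rfl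
  rw [vertex_eq_vec3]
  rcases k with k | k <;> change Fin 10 at k <;> fin_cases k
  on_goal 1 => convert vec3_mem_dodecahedron_of_signs h1 h1 h1 using 1
  on_goal 2 => convert vec3_mem_dodecahedron_of_signs h1 h1 h2 using 1
  on_goal 3 => convert vec3_mem_dodecahedron_of_signs h1 h2 h1 using 1
  on_goal 4 => convert vec3_mem_dodecahedron_of_signs h2 h1 h1 using 1
  on_goal 5 => convert vec3_cyc_mem_dodecahedron 0 h1 h1 using 1
  on_goal 6 => convert vec3_cyc_mem_dodecahedron 0 h2 h1 using 1
  on_goal 7 => convert vec3_cyc_mem_dodecahedron 1 h1 h1 using 1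
  on_goal 8 => convert vec3_cyc_mem_dodecahedron 1 h2 h1 using 1
  on_goal 9 => convert vec3_cyc_mem_dodecahedron 2 h1 h1 using 1
  on_goal 10 => convert vec3_cyc_mem_dodecahedron 2 h2 h1 using 1
  on_goal 11 => convert vec3_mem_dodecahedron_of_signs h2 h2 h2 using 1
  on_goal 12 => convert vec3_mem_dodecahedron_of_signs h2 h2 h1 using 1
  on_goal 13 => convert vec3_mem_dodecahedron_of_signs h2 h1 h2 using 1
  on_goal 14 => convert vec3_mem_dodecahedron_of_signs h1 h2 h2 using 1
  on_goal 15 => convert vec3_cyc_mem_dodecahedron 0 h2 h2 using 1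
  on_goal 16 => convert vec3_cyc_mem_dodecahedron 0 h1 h2 using 1
  on_goal 17 => convert vec3_cyc_mem_dodecahedron 1 h2 h2 using 1
  on_goal 18 => convert vec3_cyc_mem_dodecahedron 1 h1 h2 using 1
  on_goal 19 => convert vec3_cyc_mem_dodecahedron 2 h2 h2 using 1
  on_goal 20 => convert vec3_cyc_mem_dodecahedron 2 h1 h2 using 1
  all_goals
    apply vec3_congr <;> simp [vertexZ, halfTable, sqrtFiveHom_apply] <;> ring

lemma range_vertex : Set.range vertex = dodecahedron := by
  refine Set.Subset.antisymm (Set.range_subset_iff.mpr vertex_mem_dodecahedron) ?_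
  rintro v (⟨s, hs, rfl⟩ | ⟨c, s, t, hs, ht, rfl⟩)
  · rw [vec3_eta]
    exact exists_vertex_eq_of_signs (hs 0) (hs 1) (hs 2)
  · rw [phi_inv, vec3_cyc]
    exact exists_vertex_eq_of_cyc c hs ht

lemma sum_mul_le_sum_abs_sub {N : ℕ} (t : Fin N → ℝ) (h : ∑ i, t i = 0) :
    ∑ i : Fin N, (2 * (i : ℝ) + 3 - N) * t i ≤ 2⁻¹ * ∑ i, ∑ j, |t i - t j| := by
  let s : Fin N → Fin N → ℝ := fun i j => (if j < i then 1 else 0) - (if i < j then 1 else 0)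
  have hs : ∀ i, ∑ j, s i j = 2 * (i : ℝ) + 1 - N := by
    intro i
    have hi : i.val + 1 ≤ N := i.2
    have hc : (Finset.univ.filter (fun j => i < j)).card = N - (i.val + 1) := by
      rw [Finset.filter_lt_eq_Ioi, Fin.card_Ioi]; omega
    have hd : (Finset.univ.filter (fun j => j < i)).card = i.val := by
      rw [Finset.filter_gt_eq_Iio, Fin.card_Iio]
    simp only [s, Finset.sum_sub_distrib, Finset.sum_boole, hc, hd]
    push_cast [Nat.cast_sub hi]
    ring
  have hanti : ∀ i j, s i j = -s j i := fun i j => by simp only [s]; ring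
  have hle : ∀ i j, s i j * (t i - t j) ≤ |t i - t j| := by
    intro i j
    refine (le_abs_self _).trans ?_
    rw [abs_mul]
    refine mul_le_of_le_one_left (abs_nonneg _) ?_
    simp only [s]
    split_ifs <;> norm_num
  have h1 : ∑ i, ∑ j, s i j * t i = ∑ i : Fin N, (2 * (i : ℝ) + 3 - N) * t i := by
    have : ∀ i : Fin N, ∑ j, s i j * t i = (2 * (i : ℝ) + 3 - N) * t i - 2 * t i := by
      intro i
      rw [← Finset.sum_mul, hs]
      ring
    simp only [this, Finset.sum_sub_distrib, ← Finset.mul_sum, h, mul_zero, sub_zero]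
  have h2 : ∑ i, ∑ j, s i j * t j = -∑ i, ∑ j, s i j * t i := by
    rw [Finset.sum_comm, ← Finset.sum_neg_distrib]
    refine Finset.sum_congr rfl fun i _ => ?_
    rw [← Finset.sum_neg_distrib]
    refine Finset.sum_congr rfl fun j _ => ?_
    rw [hanti, neg_mul]
  have h3 : ∑ i, ∑ j, s i j * (t i - t j) ≤ ∑ i, ∑ j, |t i - t j| :=
    Finset.sum_le_sum fun i _ => Finset.sum_le_sum fun j _ => hle i j
  simp only [mul_sub, Finset.sum_sub_distrib, h2] at h3
  rw [h1] at h3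
  linarith

/-- Every enumeration of the dodecahedron arises from a reindexing of `vertex`. -/
lemma exists_equiv_of_range {v : Fin 20 → E3} (hv : Function.Injective v)
    (hr : Set.range v = dodecahedron) :
    ∃ e : Fin 20 ≃ Fin halfTable.length ⊕ Fin halfTable.length, ∀ i, v i = vertex (e i) := by
  refine ⟨(Equiv.ofInjective v hv).trans ((Equiv.setCongr (hr.trans range_vertex.symm)).trans
    (Equiv.ofInjective vertex vertex_injective).symm), fun i => ?_⟩
  simp [Equiv.apply_ofInjective_symm]

lemma sum_abs_sub_eq (u : ℝ × ℝ × ℝ) :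
    ∑ k, ∑ l, |evalAt (vertexZ k) u - evalAt (vertexZ l) u| =
      4 * absSum (sumsAndDiffs halfTable) u := by
  have h := absSum_sumsAndDiffs halfTable u
  have hsum : ∀ f : ZVec → ℝ, (halfTable.map f).sum = ∑ i : Fin halfTable.length,
      f halfTable[i] := fun f => (Fin.sum_univ_fun_getElem halfTable f).symm
  simp only [hsum] at h
  have e : (4 : ℝ) * absSum (sumsAndDiffs halfTable) u =
      2 * (2 * absSum (sumsAndDiffs halfTable) u) := by ring
  rw [e, ← h, Fintype.sum_sum_type]
  simp only [Fintype.sum_sum_type, vertexZ, evalAt_neg, ← Finset.sum_add_distrib, Finset.mul_sum]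
  refine Finset.sum_congr rfl fun i _ => Finset.sum_congr rfl fun j _ => ?_
  rw [sub_neg_eq_add, neg_sub_neg, abs_sub_comm (evalAt _ u) (evalAt halfTable[i] u),
    ← abs_neg (-evalAt _ u - _), neg_sub, sub_neg_eq_add,
    add_comm (evalAt halfTable[j] u) (evalAt halfTable[i] u)]
  ring

lemma sum_inner_vertex (w : E3) : ∑ k, inner ℝ (vertex k) w = 0 := by
  simp [inner_vertex, Fintype.sum_sum_type, vertexZ, evalAt_neg]

lemma norm_sq_tupleAvg_le {v : Fin 20 → E3} (hv : Function.Injective v)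
    (hr : Set.range v = dodecahedron) :
    ‖tupleAvg 20 v‖ ^ 2 ≤ 26568 + 11864 * Real.sqrt 5 := by
  obtain ⟨e, he⟩ := exists_equiv_of_range hv hr
  set w := tupleAvg 20 v with hw
  have hsum : ∑ i, inner ℝ (v i) w = 0 := by
    simp only [he]
    rw [Equiv.sum_comp e fun k => inner ℝ (vertex k) w, sum_inner_vertex]
  have h1 : ‖w‖ ^ 2 = ∑ i : Fin 20, (2 * (i : ℝ) + 3 - (20 : ℕ)) * inner ℝ (v i) w := by
    rw [← real_inner_self_eq_norm_sq]
    nth_rw 1 [hw]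
    simp only [tupleAvg, sum_inner, real_inner_smul_left]
  have h2 := sum_mul_le_sum_abs_sub (fun i => inner ℝ (v i) w) hsum
  rw [← h1] at h2
  have h3 : ∑ i, ∑ j, |inner ℝ (v i) w - inner ℝ (v j) w| =
      2 * absSum (sumsAndDiffs halfTable) (w 0, w 1, w 2) := by
    simp only [he]
    rw [Equiv.sum_comp e fun k => ∑ j, |inner ℝ (vertex k) w - inner ℝ (vertex (e j)) w|]
    have : ∀ k, ∑ j, |inner ℝ (vertex k) w - inner ℝ (vertex (e j)) w| =
        ∑ l, |inner ℝ (vertex k) w - inner ℝ (vertex l) w| := fun k =>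
      Equiv.sum_comp e fun l => |inner ℝ (vertex k) w - inner ℝ (vertex l) w|
    simp only [this]
    simp only [inner_vertex, ← mul_sub, abs_mul, ← Finset.mul_sum, sum_abs_sub_eq]
    rw [abs_of_pos (by norm_num : (0 : ℝ) < 2⁻¹)]
    ring
  have h4 := absSum_le (w 0, w 1, w 2)
  have h5 : w 0 ^ 2 + w 1 ^ 2 + w 2 ^ 2 = ‖w‖ ^ 2 := by
    rw [EuclideanSpace.real_norm_sq_eq, Fin.sum_univ_three]
  rw [h5] at h4
  rw [h3] at h2
  have h6 : ‖w‖ ^ 2 ≤ Real.sqrt ((26568 + 11864 * Real.sqrt 5) * ‖w‖ ^ 2) := by linarith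
  have h7 := (Real.le_sqrt (by positivity) (by positivity)).mp h6
  rcases eq_or_lt_of_le (sq_nonneg ‖w‖) with h0 | h0
  · rw [← h0]; positivity
  · nlinarith

/-- The additive map with `vertex k = vertexHom (vertexZ k)`. -/
def vertexHom : ZVec →+ E3 :=
  AddMonoidHom.mk' (fun d => (2⁻¹ : ℝ) • vec3 (sqrtFiveHom d.1) (sqrtFiveHom d.2.1)
    (sqrtFiveHom d.2.2)) fun d e => by
      rw [← smul_add]
      congr 1
      ext i
      fin_cases i <;> simp [vec3_apply]

lemma norm_sq_vertexHom (d : ZVec) : ‖vertexHom d‖ ^ 2 = sqrtFiveHom (zdot d d) / 4 := by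
  rw [EuclideanSpace.real_norm_sq_eq, Fin.sum_univ_three]
  simp only [vertexHom, AddMonoidHom.mk'_apply, PiLp.smul_apply, vec3_apply, zdot, map_add,
    map_mul, smul_eq_mul, Matrix.cons_val_zero, Matrix.cons_val_one, Matrix.cons_val]
  ring

/-- An enumeration of the vertices of maximal norm. -/
def optimalOrder : Fin 20 → Fin halfTable.length ⊕ Fin halfTable.length :=
  (![.inr 8, .inr 9, .inr 0, .inr 1, .inr 6, .inr 2, .inl 3, .inr 4, .inl 7, .inr 5,
    .inl 5, .inr 7, .inl 4, .inr 3, .inl 2, .inl 6, .inl 1, .inl 0, .inl 9, .inl 8] :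
    Fin 20 → Fin 10 ⊕ Fin 10)

lemma optimalOrder_bijective : Function.Bijective optimalOrder := by
  decide +kernel

lemma sum_optimalOrder : ∑ i : Fin 20, (2 * (i : ℤ) + 3 - 20) • vertexZ (optimalOrder i) =
    (⟨220, 100⟩, ⟨56, 24⟩, ⟨24, 16⟩) := by
  decide +kernel

lemma mem_normSqSet_dodecahedron :
    26568 + 11864 * Real.sqrt 5 ∈ normSqSet dodecahedron 20 := by
  refine ⟨fun i => vertex (optimalOrder i), vertex_injective.comp optimalOrder_bijective.1, ?_, ?_⟩
  · rw [← range_vertex]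
    exact optimalOrder_bijective.2.range_comp vertex
  · have h : tupleAvg 20 (fun i => vertex (optimalOrder i)) = vertexHom
        (∑ i : Fin 20, (2 * (i : ℤ) + 3 - 20) • vertexZ (optimalOrder i)) := by
      rw [map_sum, tupleAvg]
      refine Finset.sum_congr rfl fun i _ => ?_
      rw [map_zsmul, vertex_eq, ← Int.cast_smul_eq_zsmul ℝ]
      push_cast
      rfl
    have hW : zdot (⟨220, 100⟩, ⟨56, 24⟩, ⟨24, 16⟩) (⟨220, 100⟩, ⟨56, 24⟩, ⟨24, 16⟩) =
        ⟨106272, 47456⟩ := by decide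
    rw [h, sum_optimalOrder, norm_sq_vertexHom, hW, sqrtFiveHom_apply]
    push_cast
    ring

lemma normSqSet_smul (c : ℝ) (hc : c ≠ 0) (V : Set E3) (N : ℕ) :
    normSqSet (c • V) N = (fun x => c ^ 2 * x) '' normSqSet V N := by
  have key : ∀ (d : ℝ) (v : Fin N → E3), tupleAvg N (fun i => d • v i) = d • tupleAvg N v := by
    intro d v
    simp only [tupleAvg, Finset.smul_sum]
    exact Finset.sum_congr rfl fun i _ => smul_comm _ _ _
  ext x
  constructor
  · rintro ⟨v, hv, hr, rfl⟩
    refine ⟨_, ⟨fun i => c⁻¹ • v i, (smul_right_injective E3 (inv_ne_zero hc)).comp hv, ?_, rfl⟩,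
      ?_⟩
    · rw [show (fun i => c⁻¹ • v i) = (fun y => c⁻¹ • y) ∘ v from rfl, Set.range_comp, hr,
        Set.image_smul, inv_smul_smul₀ hc]
    · simp only [key, norm_smul, norm_inv, mul_pow, Real.norm_eq_abs, inv_pow, sq_abs]
      field_simp
  · rintro ⟨_, ⟨v, hv, rfl, rfl⟩, rfl⟩
    refine ⟨fun i => c • v i, (smul_right_injective E3 hc).comp hv, ?_, ?_⟩
    · rw [show (fun i => c • v i) = (fun y => c • y) ∘ v from rfl, Set.range_comp, Set.image_smul]
    · simp only [key, norm_smul, mul_pow, Real.norm_eq_abs, sq_abs]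

theorem dodecahedron_guesswork :
    IsGreatest (normSqSet dodecahedron 20) (26568 + 11864 * Real.sqrt 5) ∧
    IsGreatest (normSqSet ((Real.sqrt 3)⁻¹ • dodecahedron) 20)
      ((106272 + 47456 * Real.sqrt 5) / 12) ∧
    |(1 / 2 : ℝ) * (20 + 1 -
        Real.sqrt ((106272 + 47456 * Real.sqrt 5) / 12) / 20) - 7.1741| < 0.0001 := by
  have hmax : IsGreatest (normSqSet dodecahedron 20) (26568 + 11864 * Real.sqrt 5) :=
    ⟨mem_normSqSet_dodecahedron, by
      rintro _ ⟨v, hv, hr, rfl⟩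
      exact norm_sq_tupleAvg_le hv hr⟩
  refine ⟨hmax, ?_, ?_⟩
  · rw [normSqSet_smul _ (by positivity)]
    have h := (monotone_mul_left_of_nonneg (sq_nonneg (Real.sqrt 3)⁻¹)).map_isGreatest hmax
    have e : (106272 + 47456 * Real.sqrt 5) / 12 =
        (Real.sqrt 3)⁻¹ ^ 2 * (26568 + 11864 * Real.sqrt 5) := by
      rw [inv_pow, Real.sq_sqrt (by norm_num)]
      ring
    rw [e]
    exact h
  · have h1 : (2.23606 : ℝ) < Real.sqrt 5 := Real.lt_sqrt_of_sq_lt (by norm_num)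
    have h2 : Real.sqrt 5 < 2.23607 := by
      rw [Real.sqrt_lt' (by norm_num)]; norm_num
    have h3 : (133.036 : ℝ) < Real.sqrt ((106272 + 47456 * Real.sqrt 5) / 12) :=
      Real.lt_sqrt_of_sq_lt (by linarith)
    have h4 : Real.sqrt ((106272 + 47456 * Real.sqrt 5) / 12) < 133.039 := by
      rw [Real.sqrt_lt' (by norm_num)]; linarith
    rw [abs_lt]
    constructor <;> linarith
end
end
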